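/- Let p be an odd prime and α, β, γ ∈ ℤ_p with α ≠ 0. Assume: (i) ⟨−α⟩_p ≤ min{⟨−β⟩_p, ⟨−γ⟩_p}; (ii) neither (α−β+1)_{p−1} nor (α−γ+1)_{p−1} is divisible by p²; (iii) p ≤ ⟨−β⟩_p + ⟨−γ⟩_p < p + ⟨−α⟩_p. Then ∑_{k=0}^{p−1} ((α+2k)/α) · (α)_k²(β)_k(γ)_k / ((k!)²(α−β+1)_k(α−γ+1)_k) ≡ 0 (mod p²). (Since (1+α/2)_k/(α/2)_k = (α+2k)/α, this sum is the truncated series ₅F₄[α, α, 1+α/2, β, γ; 1, α/2, α−β+1, α−γ+1 | 1]_{p−1}.) -/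

import Mathlib

open scoped BigOperators

/-- The Pochhammer symbol `(x)_k = x(x+1)⋯(x+k-1)` in `ℚ_[p]`. -/
noncomputable def poch (p : ℕ) [Fact p.Prime] (x : ℚ_[p]) (k : ℕ) : ℚ_[p] :=
  (ascPochhammer ℚ_[p] k).eval x

/-- The least non-negative residue `⟨α⟩_p ∈ {0,…,p-1}` of `α ∈ ℤ_[p]` modulo `p`. -/
noncomputable def res (p : ℕ) [Fact p.Prime] (α : ℤ_[p]) : ℕ :=
  (PadicInt.toZMod α).val

section RisingFactorial

variable {R : Type*} [CommRing R]

/-- The rising factorial `x(x+1)⋯(x+k-1)` in a commutative ring. -/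
def risingFact (x : R) (k : ℕ) : R := ∏ i ∈ Finset.range k, (x + i)

@[simp] theorem risingFact_zero (x : R) : risingFact x 0 = 1 := by simp [risingFact]

theorem risingFact_succ (x : R) (k : ℕ) :
    risingFact x (k + 1) = risingFact x k * (x + k) := by
  simp [risingFact, Finset.prod_range_succ]

theorem risingFact_succ_left (x : R) (k : ℕ) :
    risingFact x (k + 1) = x * risingFact (x + 1) k := by
  simp only [risingFact, Finset.prod_range_succ', Nat.cast_zero, add_zero]
  rw [mul_comm]
  congr 1
  refine Finset.prod_congr rfl fun i _ => ?_
  push_cast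
  ring

theorem risingFact_add (x : R) (k m : ℕ) :
    risingFact x (k + m) = risingFact x k * risingFact (x + k) m := by
  induction m with
  | zero => simp
  | succ m ih =>
    rw [← add_assoc, risingFact_succ, ih, risingFact_succ]
    push_cast
    ring

theorem dvd_risingFact {x d : R} {i k : ℕ} (hi : i < k) (h : d ∣ x + i) :
    d ∣ risingFact x k :=
  h.trans (Finset.dvd_prod_of_mem _ (Finset.mem_range.2 hi))

theorem eval_ascPochhammer_eq_risingFact (x : R) (k : ℕ) :
    (ascPochhammer R k).eval x = risingFact x k := by
  induction k with
  | zero => simp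
  | succ k ih => rw [ascPochhammer_succ_eval, ih, risingFact_succ]

theorem map_risingFact {S : Type*} [CommRing S] (f : R →+* S) (x : R) (k : ℕ) :
    f (risingFact x k) = risingFact (f x) k := by
  simp [risingFact, map_prod]

theorem factorial_mul_risingFact (k m : ℕ) :
    (k.factorial : R) * risingFact ((k : R) + 1) m = ((k + m).factorial : R) := by
  induction m with
  | zero => simp
  | succ m ih =>
    rw [risingFact_succ, ← mul_assoc, ih, ← add_assoc, Nat.factorial_succ]
    push_cast
    ring

theorem risingFact_neg_natCast (n k : ℕ) :
    risingFact (-(n : R)) k = (-1) ^ k * (k.factorial * n.choose k) := by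
  induction k with
  | zero => simp
  | succ k ih =>
    rw [risingFact_succ, ih, Nat.factorial_succ]
    rcases le_or_gt k n with h | h
    · have := congrArg (Nat.cast (R := R)) (Nat.choose_succ_right_eq n k)
      push_cast [Nat.cast_sub h] at this
      push_cast
      linear_combination (-1) ^ k * (k.factorial : R) * this
    · simp [Nat.choose_eq_zero_of_lt h, Nat.choose_eq_zero_of_lt (h.trans (Nat.lt_succ_self k))]

theorem risingFact_reflect (d : R) (m : ℕ) :
    risingFact (1 - m - d) m = (-1) ^ m * risingFact d m := by
  rw [risingFact, risingFact, ← Finset.prod_range_reflect, ← Finset.card_range m,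
    ← Finset.prod_const, Finset.card_range, ← Finset.prod_mul_distrib]
  refine Finset.prod_congr rfl fun i hi => ?_
  have : m - 1 - i + (i + 1) = m := by have := Finset.mem_range.1 hi; omega
  have := congrArg (Nat.cast (R := R)) this
  push_cast at this
  linear_combination this

end RisingFactorial

section WellPoised

variable {R : Type*} [CommRing R]

/-- The terms of a very-well-poised sum of length `n`, multiplied by the common denominator
`a n! (a-d+1)_n (a-b+1)_n (a-c+1)_n`. -/
def wellPoisedTerm (n : ℕ) (a d b c : R) (k : ℕ) : R :=
  (a + 2 * k) *
    (risingFact a k * risingFact (k + 1 : R) (n - k)) *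
    (risingFact d k * risingFact (a - d + 1 + k) (n - k)) *
    (risingFact b k * risingFact (a - b + 1 + k) (n - k)) *
    (risingFact c k * risingFact (a - c + 1 + k) (n - k))

/-- The terms of the terminating very-well-poised sum with `d = -n`. -/
def terminatingTerm (n : ℕ) (a b c : R) (k : ℕ) : R :=
  (-1) ^ k * n.choose k * (a + 2 * k) * (risingFact a k * risingFact (a + n + 1 + k) (n - k)) *
    (risingFact b k * risingFact (a - b + 1 + k) (n - k)) *
    (risingFact c k * risingFact (a - c + 1 + k) (n - k))

theorem sum_terminatingTerm_telescope (n : ℕ) (a b c : R) (j : ℕ) (hj : j ≤ n) :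
    ∑ k ∈ Finset.range (j + 1), (terminatingTerm (n + 1) a b c k -
      (a + 2 * n + 1) * (a + 2 * n + 2) * (a - b - c + 1 + n) * terminatingTerm n a b c k) =
    (-1) ^ j * n.choose j *
      (risingFact a (j + 1) * risingFact (a + n + 2 + j) (n + 1 - j)) *
      (risingFact b (j + 1) * risingFact (a - b + 1 + j) (n - j)) *
      (risingFact c (j + 1) * risingFact (a - c + 1 + j) (n - j)) := by
  induction j with
  | zero =>
    have h : risingFact (a + n + 1) n * (a + 2 * n + 1) * (a + 2 * n + 2) =
        (a + n + 1) * risingFact (a + n + 2) (n + 1) := by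
      have h1 := risingFact_succ (a + n + 1) (n + 1)
      rw [risingFact_succ_left (a + n + 1) (n + 1), risingFact_succ (a + n + 1) n] at h1
      rw [show a + (n : R) + 2 = a + n + 1 + 1 by ring, h1]
      push_cast
      ring
    simp only [zero_add, Finset.sum_range_one, terminatingTerm, pow_zero, Nat.choose_zero_right,
      risingFact_zero, Nat.cast_zero, Nat.sub_zero, risingFact_succ _ 0]
    rw [risingFact_succ (a - b + 1 + 0), risingFact_succ (a - c + 1 + 0)]
    push_cast
    simp only [add_zero, mul_zero]
    rw [show a + ((n : R) + 1) + 1 = a + n + 2 by ring]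
    linear_combination
      -a * risingFact (a - b + 1) n * risingFact (a - c + 1) n * (a - b - c + 1 + n) * h
  | succ k ih =>
    obtain ⟨m, rfl⟩ := Nat.exists_eq_add_of_le hj
    rw [Finset.sum_range_succ, ih (by omega)]
    simp only [terminatingTerm]
    rw [show k + 1 + m + 1 - k = m + 1 + 1 by omega, show k + 1 + m - k = m + 1 by omega,
      show k + 1 + m + 1 - (k + 1) = m + 1 by omega, show k + 1 + m - (k + 1) = m by omega]
    have h1 := congrArg (Nat.cast (R := R)) (Nat.choose_succ_succ (k + 1 + m) k)
    have h2 := congrArg (Nat.cast (R := R)) (Nat.choose_succ_right_eq (k + 1 + m) k)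
    rw [show k + 1 + m - k = m + 1 by omega] at h2
    rw [show (k + 1 + m).succ = k + 1 + m + 1 from rfl, show k.succ = k + 1 from rfl] at h1
    push_cast at h1 h2 ⊢
    rw [risingFact_succ_left (a + (k + 1 + m) + 2 + k), risingFact_succ_left (a - b + 1 + k),
      risingFact_succ_left (a - c + 1 + k), risingFact_succ a (k + 1), risingFact_succ b (k + 1),
      risingFact_succ c (k + 1), risingFact_succ (a - b + 1 + (k + 1)),
      risingFact_succ (a - c + 1 + (k + 1))]
    rw [show a + ((k : R) + 1 + m + 1) + 1 + (k + 1) = a + (k + 1 + m) + 2 + k + 1 by ring,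
      show a + ((k : R) + 1 + m) + 2 + (k + 1) = a + (k + 1 + m) + 2 + k + 1 by ring,
      show a - b + 1 + ((k : R) + 1) = a - b + 1 + k + 1 by ring,
      show a - c + 1 + ((k : R) + 1) = a - c + 1 + k + 1 by ring,
      show a + ((k : R) + 1 + m) + 1 + (k + 1) = a + (k + 1 + m) + 2 + k by ring]
    have h3 : risingFact (a + (k + 1 + m) + 2 + k) m * (a + 2 * (k + 1 + m) + 1) *
        (a + 2 * (k + 1 + m) + 2) = (a + (k + 1 + m) + 2 + k) *
          risingFact (a + (k + 1 + m) + 2 + k + 1) (m + 1) := by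
      rw [← risingFact_succ_left, risingFact_succ, risingFact_succ]
      push_cast
      ring
    rw [h1]
    generalize risingFact (a + (k + 1 + m) + 2 + k) m = r0 at *
    generalize risingFact (a + (k + 1 + m) + 2 + k + 1) (m + 1) = r1 at *
    push_cast
    generalize risingFact a (k + 1) = ra
    generalize risingFact b (k + 1) = rb
    generalize risingFact c (k + 1) = rc
    generalize risingFact (a - b + 1 + k + 1) m = sb
    generalize risingFact (a - c + 1 + k + 1) m = sc
    generalize ((k + 1 + m).choose k : R) = u at *
    generalize ((k + 1 + m).choose (k + 1) : R) = v at *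
    linear_combination (-1) ^ k * ra * rb * rc * sb * sc * v * (a + 2 * (k + 1)) *
        (a - b - c + 1 + (k + 1 + m)) * h3 -
      (-1) ^ k * ra * rb * rc * sb * sc * r1 *
        (b * c + (k + 1) * (b + c) - (a + 2 * (k + 1)) * (a + (k + 1 + m) + 1) -
          (a + (k + 1)) * (k + 1)) * h2

theorem sum_terminatingTerm (n : ℕ) (a b c : R) :
    ∑ k ∈ Finset.range (n + 1), terminatingTerm n a b c k =
      risingFact a (2 * n + 1) * risingFact (a - b - c + 1) n := by
  induction n with
  | zero => simp [terminatingTerm, risingFact_succ]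
  | succ n ih =>
    have h := sum_terminatingTerm_telescope n a b c n le_rfl
    rw [Finset.sum_sub_distrib, ← Finset.mul_sum, ih] at h
    rw [Finset.sum_range_succ, sub_eq_iff_eq_add.1 h]
    rw [show 2 * (n + 1) + 1 = 2 * n + 1 + 1 + 1 by ring, risingFact_succ a (2 * n + 1 + 1),
      risingFact_succ a (2 * n + 1), risingFact_succ (a - b - c + 1) n]
    simp only [terminatingTerm, Nat.choose_self, Nat.sub_self, risingFact_zero]
    rw [show n + 1 - n = 1 by omega, risingFact_succ _ 0]
    push_cast
    simp only [risingFact_zero]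
    ring

theorem sum_wellPoisedTerm_of_neg (n : ℕ) (a b c : R) :
    ∑ k ∈ Finset.range (n + 1), wellPoisedTerm n a (-n) b c k =
      n.factorial * (risingFact a (2 * n + 1) * risingFact (a - b - c + 1) n) := by
  rw [← sum_terminatingTerm, Finset.mul_sum]
  refine Finset.sum_congr rfl fun k hk => ?_
  obtain ⟨m, rfl⟩ := Nat.exists_eq_add_of_le (Nat.lt_succ_iff.1 (Finset.mem_range.1 hk))
  rw [wellPoisedTerm, terminatingTerm, risingFact_neg_natCast, Nat.add_sub_cancel_left,
    ← factorial_mul_risingFact k m, sub_neg_eq_add]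
  ring

theorem wellPoisedTerm_reflect (k m : ℕ) (d b c : R) :
    wellPoisedTerm (k + m) (-((k + m : ℕ) : R)) d b c m =
      -wellPoisedTerm (k + m) (-((k + m : ℕ) : R)) d b c k := by
  have key : ∀ (k m : ℕ) (d : R), risingFact (-((k + m : ℕ) : R) - d + 1 + k) m =
      (-1) ^ m * risingFact d m := fun k m d => by
    rw [← risingFact_reflect]
    congr 1
    push_cast
    ring
  have key' : ∀ k m : ℕ, risingFact (k + 1 : R) m =
      (-1) ^ m * risingFact (-((k + m : ℕ) : R)) m := fun k m => by
    rw [← key k m]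
    congr 1
    ring
  have hk := key' k m
  have hm := key' m k
  rw [add_comm m k] at hm
  have k2 : ∀ d : R, risingFact (-((k + m : ℕ) : R) - d + 1 + m) k =
      (-1) ^ k * risingFact d k := fun d => by rw [add_comm k m, key]
  simp only [wellPoisedTerm, Nat.add_sub_cancel_left, Nat.add_sub_cancel, key, k2, hk, hm]
  have e1 : ((-1 : R) ^ k) ^ 4 = 1 := by rw [← pow_mul, mul_comm, pow_mul]; norm_num
  have e2 : ((-1 : R) ^ m) ^ 4 = 1 := by rw [← pow_mul, mul_comm, pow_mul]; norm_num
  generalize risingFact (-((k + m : ℕ) : R)) k = x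
  generalize risingFact (-((k + m : ℕ) : R)) m = y
  generalize (-1 : R) ^ k = s at *
  generalize (-1 : R) ^ m = t at *
  push_cast
  linear_combination (m - k : R) * x * y * (risingFact d k * risingFact d m) *
    (risingFact b k * risingFact b m) * (risingFact c k * risingFact c m) * (e1 - e2)

theorem sum_wellPoisedTerm_neg_eq_zero [IsDomain R] [CharZero R] (n : ℕ) (d b c : R) :
    ∑ k ∈ Finset.range (n + 1), wellPoisedTerm n (-(n : R)) d b c k = 0 := by
  rw [← self_eq_neg, ← Finset.sum_neg_distrib, ← Finset.sum_range_reflect]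
  refine Finset.sum_congr rfl fun k hk => ?_
  obtain ⟨m, rfl⟩ := Nat.exists_eq_add_of_le (Nat.lt_succ_iff.1 (Finset.mem_range.1 hk))
  rw [show k + m + 1 - 1 - k = m by omega]
  exact wellPoisedTerm_reflect k m d b c

end WellPoised

section MixedDifference

variable {R : Type*} [CommRing R]

/-- `f` looks like a polynomial in two variables when its mixed difference with step `e` is
expanded modulo `e ^ 2`. -/
def MixedExpansion (e : R) (f : R → R → R) : Prop :=
  ∃ u v w, f e 0 = f 0 0 + e * u ∧ f 0 e = f 0 0 + e * v ∧
    f e e = f 0 0 + e * (u + v) + e ^ 2 * w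

namespace MixedExpansion

variable {e : R} {f g : R → R → R}

theorem const (c : R) : MixedExpansion e fun _ _ => c := ⟨0, 0, 0, by simp⟩

theorem fst : MixedExpansion e fun x _ => x := ⟨1, 0, 0, by simp⟩

theorem snd : MixedExpansion e fun _ y => y := ⟨0, 1, 0, by simp⟩

theorem add (hf : MixedExpansion e f) (hg : MixedExpansion e g) :
    MixedExpansion e fun x y => f x y + g x y := by
  obtain ⟨u, v, w, h1, h2, h3⟩ := hf
  obtain ⟨u', v', w', h1', h2', h3'⟩ := hg
  refine ⟨u + u', v + v', w + w', ?_, ?_, ?_⟩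
  · beta_reduce; rw [h1, h1']; ring
  · beta_reduce; rw [h2, h2']; ring
  · beta_reduce; rw [h3, h3']; ring

theorem mul (hf : MixedExpansion e f) (hg : MixedExpansion e g) :
    MixedExpansion e fun x y => f x y * g x y := by
  obtain ⟨u, v, w, h1, h2, h3⟩ := hf
  obtain ⟨u', v', w', h1', h2', h3'⟩ := hg
  refine ⟨f 0 0 * u' + u * g 0 0 + e * (u * u'), f 0 0 * v' + v * g 0 0 + e * (v * v'),
    f 0 0 * w' + w * g 0 0 + u * v' + v * u' + e * ((u + v) * w' + w * (u' + v')) +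
      e ^ 2 * (w * w'), ?_, ?_, ?_⟩
  · beta_reduce; rw [h1, h1']; ring
  · beta_reduce; rw [h2, h2']; ring
  · beta_reduce; rw [h3, h3']; ring

theorem sub (hf : MixedExpansion e f) (hg : MixedExpansion e g) :
    MixedExpansion e fun x y => f x y - g x y := by
  simpa [sub_eq_add_neg] using hf.add ((const (-1)).mul hg)

theorem sum {f : ℕ → R → R → R} {n : ℕ} (hf : ∀ k, MixedExpansion e (f k)) :
    MixedExpansion e fun x y => ∑ k ∈ Finset.range n, f k x y := by
  induction n with
  | zero => simpa using const (0 : R)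
  | succ n ih => simpa only [Finset.sum_range_succ] using ih.add (hf n)

theorem risingFact (hf : MixedExpansion e f) (k : ℕ) :
    MixedExpansion e fun x y => risingFact (f x y) k := by
  induction k with
  | zero => simpa using const (1 : R)
  | succ k ih => simpa only [risingFact_succ] using ih.mul (hf.add (const (k : R)))

theorem wellPoisedTerm {h i : R → R → R} (hf : MixedExpansion e f) (hg : MixedExpansion e g)
    (hh : MixedExpansion e h) (hi : MixedExpansion e i) (n k : ℕ) :
    MixedExpansion e fun x y => wellPoisedTerm n (f x y) (g x y) (h x y) (i x y) k := by
  have key : ∀ {j : R → R → R}, MixedExpansion e j → MixedExpansion e fun x y =>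
      _root_.risingFact (j x y) k * _root_.risingFact (f x y - j x y + 1 + k) (n - k) :=
    fun hj => (hj.risingFact k).mul ((((hf.sub hj).add (const 1)).add (const (k : R))).risingFact _)
  exact ((((hf.add (const (2 * k : R))).mul ((hf.risingFact k).mul (const _))).mul (key hg)).mul
    (key hh)).mul (key hi)

theorem sq_dvd (hf : MixedExpansion e f) : e ^ 2 ∣ f e e - f e 0 - f 0 e + f 0 0 := by
  obtain ⟨u, v, w, h1, h2, h3⟩ := hf
  exact ⟨w, by rw [h1, h2, h3]; ring⟩

end MixedExpansion

theorem sq_dvd_sum_wellPoisedTerm [IsDomain R] [CharZero R] {q a b c : R} {n i : ℕ}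
    (hq : q ∣ a + n) (hi : i < n) (hi' : q ∣ a - b - c + 1 + i) :
    q ^ 2 ∣ ∑ k ∈ Finset.range (n + 1), wellPoisedTerm n a a b c k := by
  obtain ⟨e, he⟩ : ∃ e, e = a + n := ⟨_, rfl⟩
  have ha : a = -(n : R) + e := by rw [he]; ring
  have hM : MixedExpansion e fun x y => ∑ k ∈ Finset.range (n + 1),
      wellPoisedTerm n (-(n : R) + x) (-(n : R) + y) b c k :=
    MixedExpansion.sum fun k => MixedExpansion.wellPoisedTerm
      ((MixedExpansion.const _).add MixedExpansion.fst)
      ((MixedExpansion.const _).add MixedExpansion.snd)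
      (MixedExpansion.const b) (MixedExpansion.const c) n k
  have h := hM.sq_dvd
  simp only [add_zero, sum_wellPoisedTerm_neg_eq_zero, sub_zero, ← ha] at h
  rw [sum_wellPoisedTerm_of_neg] at h
  refine (dvd_sub_left (Dvd.dvd.mul_left ?_ _)).1 ((pow_dvd_pow_of_dvd (he ▸ hq) 2).trans h)
  rw [pow_two]
  exact mul_dvd_mul (dvd_risingFact (by omega : n < 2 * n + 1) hq) (dvd_risingFact hi hi')

end MixedDifference

theorem norm_risingFact_eq_one {p : ℕ} [Fact p.Prime] {x : ℤ_[p]} {k : ℕ}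
    (h : ∀ i < k, ¬ (p : ℤ_[p]) ∣ x + i) : ‖risingFact x k‖ = 1 := by
  rw [risingFact, norm_prod]
  refine Finset.prod_eq_one fun i hi => ?_
  refine le_antisymm (PadicInt.norm_le_one _) (not_lt.1 fun hlt => ?_)
  exact h i (Finset.mem_range.1 hi) ((PadicInt.norm_lt_one_iff_dvd _).1 hlt)

theorem dvd_add_natCast_iff_of_res {p : ℕ} [Fact p.Prime] {x : ℤ_[p]} {m : ℤ}
    (hx : PadicInt.toZMod x = (m : ZMod p)) (i : ℕ) :
    (p : ℤ_[p]) ∣ x + i ↔ (p : ℤ) ∣ m + i := by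
  rw [← PadicInt.norm_lt_one_iff_dvd, ← PadicInt.mem_nonunits,
    ← IsLocalRing.mem_maximalIdeal, ← PadicInt.ker_toZMod, RingHom.mem_ker, map_add, map_natCast,
    hx, ← ZMod.intCast_zmod_eq_zero_iff_dvd]
  push_cast
  rfl

theorem norm_risingFact_eq_one_of_res {p : ℕ} [Fact p.Prime] {y : ℤ_[p]} {m k : ℕ}
    (hy : PadicInt.toZMod y = ((m : ℤ) : ZMod p)) (hm : 0 < m) (hmk : m + k ≤ p) :
    ‖risingFact y k‖ = 1 :=
  norm_risingFact_eq_one fun i hi => by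
    rw [dvd_add_natCast_iff_of_res hy]
    exact_mod_cast Nat.not_dvd_of_pos_of_lt (by omega) (by omega)

theorem norm_risingFact_le_of_lt {p : ℕ} [Fact p.Prime] {x : ℤ_[p]} {r k : ℕ}
    (hx : PadicInt.toZMod x = ((-(r : ℤ) : ℤ) : ZMod p)) (hk : r < k) :
    ‖risingFact x k‖ ≤ (p : ℝ) ^ (-1 : ℤ) := by
  have h : (p : ℤ_[p]) ^ 1 ∣ risingFact x k := by
    rw [pow_one]
    exact dvd_risingFact hk ((dvd_add_natCast_iff_of_res hx r).2 (by simp))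
  exact_mod_cast (PadicInt.norm_le_pow_iff_mem_span_pow _ 1).2 (Ideal.mem_span_singleton.2 h)

theorem le_norm_risingFact {p : ℕ} [Fact p.Prime] {y : ℤ_[p]} {k : ℕ}
    (h : ¬ (p : ℤ_[p]) ^ 2 ∣ risingFact y (p - 1)) (hk : k < p) :
    (p : ℝ) ^ (-1 : ℤ) ≤ ‖risingFact y k‖ := by
  refine not_lt.1 fun hlt => h ?_
  have hlt' : ‖risingFact y k‖ < (p : ℝ) ^ ((-2 : ℤ) + 1) := by simpa using hlt
  have h2 := (PadicInt.norm_le_pow_iff_norm_lt_pow_add_one _ _).2 hlt'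
  have h3 := Ideal.mem_span_singleton.1
    ((PadicInt.norm_le_pow_iff_mem_span_pow (risingFact y k) 2).1 (by exact_mod_cast h2))
  obtain ⟨m, hm⟩ := Nat.exists_eq_add_of_le (Nat.le_sub_one_of_lt hk)
  rw [hm, risingFact_add]
  exact h3.mul_right _

theorem norm_risingFact_le_norm_risingFact {p : ℕ} [Fact p.Prime] {x y : ℤ_[p]} {m r k : ℕ}
    (hx : PadicInt.toZMod x = ((-(r : ℤ) : ℤ) : ZMod p))
    (hy : PadicInt.toZMod y = ((m : ℤ) : ZMod p)) (hm : 0 < m) (hmr : m + r ≤ p)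
    (h : ¬ (p : ℤ_[p]) ^ 2 ∣ risingFact y (p - 1)) (hk : k < p) :
    ‖risingFact x k‖ ≤ ‖risingFact y k‖ := by
  rcases le_or_gt k r with hkr | hkr
  · rw [norm_risingFact_eq_one_of_res hy hm (by omega)]
    exact PadicInt.norm_le_one _
  · exact (norm_risingFact_le_of_lt hx hkr).trans (le_norm_risingFact h hk)

theorem norm_natCast_factorial_eq_one {p : ℕ} [Fact p.Prime] {k : ℕ} (hk : k < p) :
    ‖(k.factorial : ℚ_[p])‖ = 1 := by
  rw [Padic.norm_natCast_eq_one_iff]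
  exact (Fact.out : p.Prime).coprime_factorial_of_lt hk

theorem poch_coe (p : ℕ) [Fact p.Prime] (x : ℤ_[p]) (k : ℕ) :
    poch p (x : ℚ_[p]) k = ((risingFact x k : ℤ_[p]) : ℚ_[p]) := by
  rw [poch, eval_ascPochhammer_eq_risingFact]
  exact (map_risingFact PadicInt.Coe.ringHom x k).symm

theorem toZMod_eq_neg_res (p : ℕ) [Fact p.Prime] (x : ℤ_[p]) :
    PadicInt.toZMod x = ((-(res p (-x) : ℤ) : ℤ) : ZMod p) := by
  simp [res]

theorem wellPoisedTerm_eq_mul {p : ℕ} [Fact p.Prime] {α β γ : ℤ_[p]} {n k : ℕ} (hk : k ≤ n)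
    (hα : α ≠ 0) (hβ : risingFact (α - β + 1) n ≠ 0) (hγ : risingFact (α - γ + 1) n ≠ 0) :
    (((α : ℚ_[p]) + 2 * k) / (α : ℚ_[p])) *
      (poch p (α : ℚ_[p]) k ^ 2 * poch p (β : ℚ_[p]) k * poch p (γ : ℚ_[p]) k)
      / ((Nat.factorial k : ℚ_[p]) ^ 2 * poch p ((α : ℚ_[p]) - (β : ℚ_[p]) + 1) k
          * poch p ((α : ℚ_[p]) - (γ : ℚ_[p]) + 1) k) =
    ((wellPoisedTerm n α α β γ k : ℤ_[p]) : ℚ_[p]) /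
      ((α * (n.factorial : ℤ_[p]) ^ 2 * risingFact (α - β + 1) n * risingFact (α - γ + 1) n :
        ℤ_[p]) : ℚ_[p]) := by
  obtain ⟨m, rfl⟩ := Nat.exists_eq_add_of_le hk
  have hn0 : ((k + m).factorial : ℤ_[p]) ≠ 0 := by exact_mod_cast (k + m).factorial_ne_zero
  rw [← factorial_mul_risingFact] at hn0 ⊢
  rw [risingFact_add] at hβ hγ
  rw [show (α : ℚ_[p]) - β + 1 = ((α - β + 1 : ℤ_[p]) : ℚ_[p]) by push_cast; rfl,
    show (α : ℚ_[p]) - γ + 1 = ((α - γ + 1 : ℤ_[p]) : ℚ_[p]) by push_cast; rfl]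
  simp only [poch_coe]
  have hk0 : (k.factorial : ℚ_[p]) ≠ 0 := by exact_mod_cast k.factorial_ne_zero
  have c : ∀ {x : ℤ_[p]}, x ≠ 0 → (x : ℚ_[p]) ≠ 0 := fun hx => PadicInt.coe_ne_zero.2 hx
  have hα' := c hα
  have h1 := c (left_ne_zero_of_mul hβ)
  have h2 := c (right_ne_zero_of_mul hβ)
  have h3 := c (left_ne_zero_of_mul hγ)
  have h4 := c (right_ne_zero_of_mul hγ)
  have h5 := c (right_ne_zero_of_mul hn0)
  rw [wellPoisedTerm, risingFact_add (α - β + 1), risingFact_add (α - γ + 1),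
    Nat.add_sub_cancel_left, sub_self, zero_add, add_comm (1 : ℤ_[p]) (k : ℤ_[p])]
  have two : ((2 : ℤ_[p]) : ℚ_[p]) = 2 := rfl
  push_cast [two] at *
  field_simp

/-- Vanishing case of the p-adic `₅F₄` identity:
the truncated very-well-poised `₅F₄` series is `≡ 0 (mod p²)`. -/
theorem padic_5F4_vanishing
    (p : ℕ) [Fact p.Prime] (hp : Odd p) (α β γ : ℤ_[p]) (hα : α ≠ 0)
    (h1a : res p (-α) ≤ res p (-β)) (h1b : res p (-α) ≤ res p (-γ))
    (h2a : ¬ ((p : ℤ_[p]) ^ 2 ∣ (ascPochhammer ℤ_[p] (p - 1)).eval (α - β + 1)))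
    (h2b : ¬ ((p : ℤ_[p]) ^ 2 ∣ (ascPochhammer ℤ_[p] (p - 1)).eval (α - γ + 1)))
    (h3a : p ≤ res p (-β) + res p (-γ))
    (h3b : res p (-β) + res p (-γ) < p + res p (-α)) :
    ‖∑ k ∈ Finset.range p,
        (((α : ℚ_[p]) + 2 * k) / (α : ℚ_[p])) *
          (poch p (α : ℚ_[p]) k ^ 2 * poch p (β : ℚ_[p]) k * poch p (γ : ℚ_[p]) k)
          / ((Nat.factorial k : ℚ_[p]) ^ 2 * poch p ((α : ℚ_[p]) - (β : ℚ_[p]) + 1) k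
              * poch p ((α : ℚ_[p]) - (γ : ℚ_[p]) + 1) k)‖
      ≤ (p : ℝ) ^ (-2 : ℤ) := by
  rw [eval_ascPochhammer_eq_risingFact] at h2a h2b
  have hαr := toZMod_eq_neg_res p α
  have hβr := toZMod_eq_neg_res p β
  have hγr := toZMod_eq_neg_res p γ
  have hap : res p (-α) < p := ZMod.val_lt _
  have hbp : res p (-β) < p := ZMod.val_lt _
  have hcp : res p (-γ) < p := ZMod.val_lt _
  generalize res p (-α) = a at *
  generalize res p (-β) = b at *
  generalize res p (-γ) = c at *
  have hp0 : (0 : ℝ) < p := by exact_mod_cast (Fact.out : p.Prime).pos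
  have hαβ : PadicInt.toZMod (α - β + 1) = (((b - a + 1 : ℕ) : ℤ) : ZMod p) := by
    rw [map_add, map_sub, hαr, hβr]
    push_cast [Nat.cast_sub h1a]
    simp
    ring
  have hαγ : PadicInt.toZMod (α - γ + 1) = (((c - a + 1 : ℕ) : ℤ) : ZMod p) := by
    rw [map_add, map_sub, hαr, hγr]
    push_cast [Nat.cast_sub h1b]
    simp
    ring
  have hβ1 := norm_risingFact_eq_one_of_res hαβ (Nat.succ_pos _) (k := a) (by omega)
  have hγ1 := norm_risingFact_eq_one_of_res hαγ (Nat.succ_pos _) (k := a) (by omega)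
  have hα1 : ‖α‖ = 1 := by
    refine le_antisymm (PadicInt.norm_le_one _) (not_lt.1 fun hlt => ?_)
    have h := (dvd_add_natCast_iff_of_res hαr 0).1
      (by simpa using (PadicInt.norm_lt_one_iff_dvd α).1 hlt)
    have h' : p ∣ a := by
      rw [Nat.cast_zero, add_zero, dvd_neg] at h
      exact_mod_cast h
    exact Nat.not_dvd_of_pos_of_lt (by omega) hap h'
  rw [← Finset.sum_range_add_sum_Ico _ (Nat.succ_le_of_lt hap)]
  refine (Padic.nonarchimedean _ _).trans (max_le ?_ ?_)
  · rw [Finset.sum_congr rfl fun k hk => wellPoisedTerm_eq_mul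
      (Nat.lt_succ_iff.1 (Finset.mem_range.1 hk)) hα
      (norm_ne_zero_iff.1 (by rw [hβ1]; exact one_ne_zero))
      (norm_ne_zero_iff.1 (by rw [hγ1]; exact one_ne_zero)), ← Finset.sum_div, norm_div,
      ← PadicInt.coe_sum, ← PadicInt.norm_def, ← PadicInt.norm_def]
    have hf : ‖(a.factorial : ℤ_[p])‖ = 1 := by
      rw [PadicInt.norm_def, PadicInt.coe_natCast, norm_natCast_factorial_eq_one hap]
    rw [norm_mul, norm_mul, norm_mul, norm_pow, hf, hα1, hβ1, hγ1]
    simp only [one_pow, mul_one, div_one]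
    have hd : (p : ℤ_[p]) ^ 2 ∣ ∑ k ∈ Finset.range (a + 1), wellPoisedTerm a α α β γ k := by
      refine sq_dvd_sum_wellPoisedTerm (i := p - 1 - (b + c - a)) ?_ (by omega) ?_
      · exact (dvd_add_natCast_iff_of_res hαr a).2 (by simp)
      · have h : PadicInt.toZMod (α - β - γ + 1) = ((b + c - a + 1 : ℤ) : ZMod p) := by
          rw [map_add, map_sub, map_sub, hαr, hβr, hγr]
          push_cast
          simp
          ring
        refine (dvd_add_natCast_iff_of_res h _).2 ?_
        rw [show (b + c - a + 1 : ℤ) + (p - 1 - (b + c - a) : ℕ) = p by omega]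
    exact_mod_cast (PadicInt.norm_le_pow_iff_mem_span_pow _ 2).2 (Ideal.mem_span_singleton.2 hd)
  · refine IsUltrametricDist.norm_sum_le_of_forall_le_of_nonneg (by positivity) fun k hk => ?_
    obtain ⟨hak, hkp⟩ := Finset.mem_Ico.1 hk
    rw [show (α : ℚ_[p]) - β + 1 = ((α - β + 1 : ℤ_[p]) : ℚ_[p]) by push_cast; rfl,
      show (α : ℚ_[p]) - γ + 1 = ((α - γ + 1 : ℤ_[p]) : ℚ_[p]) by push_cast; rfl]
    simp only [poch_coe]
    rw [show (α : ℚ_[p]) + 2 * k = ((α + 2 * k : ℤ_[p]) : ℚ_[p]) by push_cast; rfl]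
    simp only [norm_div, norm_mul, norm_pow, norm_natCast_factorial_eq_one hkp,
      ← PadicInt.norm_def, hα1]
    have hA := norm_risingFact_le_of_lt hαr hak
    have hB := norm_risingFact_le_norm_risingFact hβr hαγ (Nat.succ_pos _) (by omega) h2b hkp
    have hC := norm_risingFact_le_norm_risingFact hγr hαβ (Nat.succ_pos _) (by omega) h2a hkp
    have hp1 : (0 : ℝ) < (p : ℝ) ^ (-1 : ℤ) := by positivity
    have hD := hp1.trans_le (le_norm_risingFact h2a hkp)
    have hE := hp1.trans_le (le_norm_risingFact h2b hkp)
    rw [one_pow, one_mul, div_one, div_le_iff₀ (mul_pos hD hE)]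
    calc ‖α + 2 * (k : ℤ_[p])‖ *
          (‖risingFact α k‖ ^ 2 * ‖risingFact β k‖ * ‖risingFact γ k‖)
        ≤ 1 * (((p : ℝ) ^ (-1 : ℤ)) ^ 2 * ‖risingFact (α - γ + 1) k‖ *
            ‖risingFact (α - β + 1) k‖) := by
          gcongr
          exact PadicInt.norm_le_one _
      _ = (p : ℝ) ^ (-2 : ℤ) *
          (‖risingFact (α - β + 1) k‖ * ‖risingFact (α - γ + 1) k‖) := by
          rw [← zpow_natCast, ← zpow_mul]
          norm_num
          ring
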